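/- arXiv:2211.05345 — 2 statements merged into one kernel-verified Lean document; each statement's English description precedes it below -/
import Mathlib

section
/- For every integer k ≥ 3 there exist constants C > 0 and c > 0 with the following property. Let S be a finite set of n ≥ 2 closed line segments in ℝ² (each segment being the convex hull of two distinct points) such that no k-element subset of S consists of pairwise intersecting segments. Then the intersection graph of S admits a biclique cover of size at most C·n·(log n)^c in which, moreover, each segment belongs to at most C·(log n)^c of the sets Aᵢ and at most C·(log n)^c of the sets Bᵢ. -/
open Classical in
theorem dilworth_aux {V : Type} [Fintype V] (r : V → V → Prop)
    (htr : ∀ a b c, r a b → r b c → r a c) (hir : ∀ a, ¬ r a a) :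
    ∀ (n : ℕ) (P : Finset V) (w : ℕ), P.card = n →
      (∀ T : Finset V, T ⊆ P → (∀ a ∈ T, ∀ b ∈ T, ¬ r a b) → T.card ≤ w) →
      ∃ f : V → ℕ, (∀ u ∈ P, f u < w) ∧
        ∀ u ∈ P, ∀ v ∈ P, f u = f v → u = v ∨ r u v ∨ r v u := by
  have hmax : ∀ M : Set V, M.Nonempty → ∃ x ∈ M, ∀ z ∈ M, ¬ r x z := by
    intro M hM
    have : IsTrans V (fun a b => r b a) := ⟨fun a b c h1 h2 => htr _ _ _ h2 h1⟩
    have : Std.Irrefl (fun a b : V => r b a) := ⟨fun a => hir a⟩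
    have wf : WellFounded (fun a b : V => r b a) := Finite.wellFounded_of_trans_of_irrefl _
    obtain ⟨x, hx, h⟩ := wf.has_min M hM
    exact ⟨x, hx, fun z hz => h z hz⟩
  intro n
  induction n using Nat.strong_induction_on with
  | _ n ih =>
  intro P w hP hw
  rcases P.eq_empty_or_nonempty with rfl | hne
  · exact ⟨fun _ => 0, by simp, by simp⟩
  obtain ⟨a, haP, hamax⟩ := hmax (P : Set V) hne
  have haP : a ∈ P := haP
  have hamax : ∀ z ∈ P, ¬ r a z := hamax
  have hcard : (P.erase a).card < n := by
    rw [← hP]; exact Finset.card_erase_lt_of_mem haP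
  have hw1 : 1 ≤ w := by
    have := hw {a} (by simpa using haP) (by simp [hir])
    simpa using this
  -- a combination step: remove a chain and use the remaining colours
  have step : ∀ K : Finset V, a ∈ K → K ⊆ P →
      (∀ u ∈ K, ∀ v ∈ K, u = v ∨ r u v ∨ r v u) →
      (∀ T : Finset V, T ⊆ P \ K → (∀ a ∈ T, ∀ b ∈ T, ¬ r a b) → T.card ≤ w - 1) →
      ∃ f : V → ℕ, (∀ u ∈ P, f u < w) ∧
        ∀ u ∈ P, ∀ v ∈ P, f u = f v → u = v ∨ r u v ∨ r v u := by
    intro K haK hKP hK hT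
    have hlt : (P \ K).card < n := by
      rw [← hP]
      apply Finset.card_lt_card
      refine ⟨Finset.sdiff_subset, fun h => ?_⟩
      have := h haP
      simp [haK] at this
    obtain ⟨f, hf1, hf2⟩ := ih _ hlt (P \ K) (w - 1) rfl hT
    refine ⟨fun u => if u ∈ K then w - 1 else f u, ?_, ?_⟩
    · intro u hu
      by_cases huK : u ∈ K
      · simp [huK]; omega
      · have := hf1 u (by simp [hu, huK])
        simp [huK]; omega
    · intro u hu v hv huv
      by_cases huK : u ∈ K <;> by_cases hvK : v ∈ K
      · exact hK u huK v hvK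
      · have := hf1 v (by simp [hv, hvK])
        simp [huK, hvK] at huv; omega
      · have := hf1 u (by simp [hu, huK])
        simp [huK, hvK] at huv; omega
      · simp [huK, hvK] at huv
        exact hf2 u (by simp [hu, huK]) v (by simp [hv, hvK]) huv
  by_cases hbig : ∃ T : Finset V, T ⊆ P.erase a ∧ (∀ a ∈ T, ∀ b ∈ T, ¬ r a b) ∧ T.card = w
  swap
  · apply step {a} (by simp) (by simpa using haP) (by simp)
    intro T hT hanti
    have h1 : T ⊆ P.erase a := by
      intro z hz
      have := hT hz
      simp at this
      simp [this]
    have h2 := hw T (h1.trans (Finset.erase_subset _ _)) hanti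
    by_contra hcon
    exact hbig ⟨T, h1, hanti, by omega⟩
  obtain ⟨f, hf1, hf2⟩ := ih _ hcard (P.erase a) w rfl
    (fun T hT => hw T (hT.trans (Finset.erase_subset _ _)))
  -- every big antichain hits every colour
  have hit : ∀ T : Finset V, T ⊆ P.erase a → (∀ a ∈ T, ∀ b ∈ T, ¬ r a b) → T.card = w →
      ∀ j < w, ∃ y ∈ T, f y = j := by
    intro T hT hanti hTw j hj
    have hinj : Set.InjOn f T := by
      intro u hu v hv huv
      rcases hf2 u (hT hu) v (hT hv) huv with h | h | h
      · exact h
      · exact absurd h (hanti u hu v hv)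
      · exact absurd h (hanti v hv u hu)
    have h1 : T.image f = Finset.range w := by
      apply Finset.eq_of_subset_of_card_le
      · intro y hy
        obtain ⟨u, hu, rfl⟩ := Finset.mem_image.1 hy
        exact Finset.mem_range.2 (hf1 u (hT hu))
      · rw [Finset.card_image_of_injOn hinj, hTw, Finset.card_range]
    have : j ∈ T.image f := by rw [h1]; simpa using hj
    simpa using this
  have hx : ∀ j : Fin w, ∃ x : V, (x ∈ P.erase a ∧ f x = j ∧ ∃ T : Finset V, T ⊆ P.erase a ∧
      (∀ a ∈ T, ∀ b ∈ T, ¬ r a b) ∧ T.card = w ∧ x ∈ T) ∧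
      ∀ z, z ∈ P.erase a → f z = j → (∃ T : Finset V, T ⊆ P.erase a ∧
        (∀ a ∈ T, ∀ b ∈ T, ¬ r a b) ∧ T.card = w ∧ z ∈ T) → z = x ∨ r z x := by
    intro j
    obtain ⟨T, hT, hanti, hTw⟩ := hbig
    obtain ⟨y, hy, hyj⟩ := hit T hT hanti hTw j j.2
    obtain ⟨x, hxM, hx⟩ := hmax {x | x ∈ P.erase a ∧ f x = j ∧ ∃ T : Finset V, T ⊆ P.erase a ∧
      (∀ a ∈ T, ∀ b ∈ T, ¬ r a b) ∧ T.card = w ∧ x ∈ T} ⟨y, hT hy, hyj, T, hT, hanti, hTw, hy⟩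
    refine ⟨x, hxM, fun z h1 h2 h3 => ?_⟩
    have := hx z ⟨h1, h2, h3⟩
    rcases hf2 z h1 x hxM.1 (h2.trans hxM.2.1.symm) with h | h | h
    · exact Or.inl h
    · exact Or.inr h
    · exact absurd h this
  choose x hx1 hx2 using hx
  have hxanti : ∀ i j, ¬ r (x i) (x j) := by
    intro i j hr
    obtain ⟨_, hi, T, hT, hanti, hTw, hxT⟩ := hx1 j
    obtain ⟨y, hy, hyi⟩ := hit T hT hanti hTw i i.2
    rcases hx2 i y (hT hy) hyi ⟨T, hT, hanti, hTw, hy⟩ with h | h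
    · subst h; exact hanti _ hy _ hxT hr
    · exact hanti _ hy _ hxT (htr _ _ _ h hr)
  have hxinj : Function.Injective x := by
    intro i j hij
    have h1 := (hx1 i).2.1
    have h2 := (hx1 j).2.1
    rw [hij] at h1
    exact Fin.ext (h1.symm.trans h2)
  by_cases hex : ∃ i, r (x i) a
  swap
  · exfalso
    have hna : a ∉ Finset.univ.image x := by
      intro h
      obtain ⟨i, _, hi⟩ := Finset.mem_image.1 h
      have := (hx1 i).1
      rw [hi] at this
      simp at this
    have := hw (insert a (Finset.univ.image x)) (by
      intro z hz
      rcases Finset.mem_insert.1 hz with rfl | hz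
      · exact haP
      · obtain ⟨i, _, rfl⟩ := Finset.mem_image.1 hz
        exact Finset.erase_subset _ _ (hx1 i).1) (by
      intro u hu v hv
      rcases Finset.mem_insert.1 hu with hu1 | hu1 <;>
        rcases Finset.mem_insert.1 hv with hv1 | hv1
      · rw [hu1, hv1]; exact hir _
      · obtain ⟨i, _, rfl⟩ := Finset.mem_image.1 hv1
        rw [hu1]
        exact hamax _ (Finset.erase_subset _ _ (hx1 i).1)
      · obtain ⟨i, _, rfl⟩ := Finset.mem_image.1 hu1
        rw [hv1]
        exact fun h => hex ⟨i, h⟩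
      · obtain ⟨i, _, rfl⟩ := Finset.mem_image.1 hv1
        obtain ⟨j, _, rfl⟩ := Finset.mem_image.1 hu1
        exact hxanti _ _)
    rw [Finset.card_insert_of_notMem hna, Finset.card_image_of_injective _ hxinj,
      Finset.card_univ, Fintype.card_fin] at this
    omega
  obtain ⟨i, hi⟩ := hex
  apply step (insert a ((P.erase a).filter (fun z => f z = i ∧ (z = x i ∨ r z (x i))))) (by simp)
  · intro z hz
    rcases Finset.mem_insert.1 hz with rfl | hz
    · exact haP
    · exact Finset.erase_subset _ _ (Finset.mem_filter.1 hz).1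
  · have hza : ∀ z, (z = x i ∨ r z (x i)) → r z a := by
      rintro z (rfl | h)
      · exact hi
      · exact htr _ _ _ h hi
    intro u hu v hv
    rcases Finset.mem_insert.1 hu with rfl | hu <;> rcases Finset.mem_insert.1 hv with rfl | hv
    · exact Or.inl rfl
    · exact Or.inr (Or.inr (hza _ (Finset.mem_filter.1 hv).2.2))
    · exact Or.inr (Or.inl (hza _ (Finset.mem_filter.1 hu).2.2))
    · rw [Finset.mem_filter] at hu hv
      exact hf2 u hu.1 v hv.1 (hu.2.1.trans hv.2.1.symm)
  · intro T hT hanti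
    have h1 : T ⊆ P.erase a := by
      intro z hz
      have := hT hz
      simp only [Finset.mem_sdiff, Finset.mem_insert, not_or] at this
      simp [this.1, this.2.1]
    have h2 := hw T (h1.trans (Finset.erase_subset _ _)) hanti
    by_contra hcon
    have hTw : T.card = w := by omega
    obtain ⟨y, hy, hyi⟩ := hit T h1 hanti hTw i i.2
    have h3 := hx2 i y (h1 hy) hyi ⟨T, h1, hanti, hTw, hy⟩
    have h4 := hT hy
    rw [Finset.mem_sdiff] at h4
    exact h4.2 (Finset.mem_insert_of_mem (Finset.mem_filter.2 ⟨h1 hy, hyi, h3⟩))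

/-- A biclique cover of the pairs in `R` by bicliques of `G`, each vertex lying in at most `d`
left sides and at most `d` right sides. -/
def BCov {V : Type} (R G : V → V → Prop) (d : ℕ) : Prop :=
  ∃ (ι : Type) (_ : Finite ι) (A B : ι → Set V),
    (∀ i, ∀ a ∈ A i, ∀ b ∈ B i, G a b) ∧
    (∀ u v, R u v → ∃ i, (u ∈ A i ∧ v ∈ B i) ∨ (v ∈ A i ∧ u ∈ B i)) ∧
    ∀ v, {i | v ∈ A i}.ncard ≤ d ∧ {i | v ∈ B i}.ncard ≤ d

theorem BCov.mono_symm {V : Type} {R R' G : V → V → Prop} {d : ℕ} (h : BCov R' G d)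
    (hR : ∀ u v, R u v → R' u v ∨ R' v u) : BCov R G d := by
  obtain ⟨ι, hι, A, B, h1, h2, h3⟩ := h
  refine ⟨ι, hι, A, B, h1, ?_, h3⟩
  intro u v huv
  rcases hR u v huv with h | h
  · exact h2 u v h
  · obtain ⟨i, hi⟩ := h2 v u h
    exact ⟨i, hi.symm⟩

theorem sigma_ncard_le {I : Type} [Finite I] {ι : I → Type} [∀ i, Finite (ι i)] (e d : ℕ)
    (Q : Set I) (hQ : Q.ncard ≤ e) (X : ∀ i, Set (ι i)) (hX : ∀ i, (X i).ncard ≤ d) :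
    {p : Σ i, ι i | p.2 ∈ X p.1 ∧ p.1 ∈ Q}.ncard ≤ e * d := by
  classical
  have := Fintype.ofFinite I
  have := fun i => Fintype.ofFinite (ι i)
  have h : {p : Σ i, ι i | p.2 ∈ X p.1 ∧ p.1 ∈ Q} =
      ((Q.toFinset.sigma fun i => (X i).toFinset : Finset (Σ i, ι i)) : Set (Σ i, ι i)) := by
    ext p; simp [and_comm]
  rw [h, Set.ncard_coe_finset, Finset.card_sigma]
  calc ∑ i ∈ Q.toFinset, (X i).toFinset.card ≤ ∑ i ∈ Q.toFinset, d := by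
        apply Finset.sum_le_sum
        intro i _
        rw [← Set.ncard_eq_toFinset_card']
        exact hX i
    _ = Q.ncard * d := by
        rw [Finset.sum_const, smul_eq_mul, ← Set.ncard_eq_toFinset_card']
    _ ≤ e * d := Nat.mul_le_mul_right _ hQ

theorem BCov.union {V : Type} {R G : V → V → Prop} {d e : ℕ} {I : Type} [Finite I]
    (W : I → Set V) (hW : ∀ v, {i | v ∈ W i}.ncard ≤ e) (Ri : I → V → V → Prop)
    (h : ∀ i, BCov (Ri i) G d)
    (hR : ∀ u v, R u v → ∃ i, u ∈ W i ∧ v ∈ W i ∧ Ri i u v) : BCov R G (e * d) := by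
  choose ι hι A B h1 h2 h3 using h
  refine ⟨Σ i, ι i, inferInstance, fun p => A p.1 p.2 ∩ W p.1, fun p => B p.1 p.2 ∩ W p.1,
    ?_, ?_, ?_⟩
  · intro p a ha b hb
    exact h1 p.1 p.2 a ha.1 b hb.1
  · intro u v huv
    obtain ⟨i, hu, hv, hi⟩ := hR u v huv
    obtain ⟨j, hj⟩ := h2 i u v hi
    refine ⟨⟨i, j⟩, ?_⟩
    rcases hj with hj | hj
    · exact Or.inl ⟨⟨hj.1, hu⟩, ⟨hj.2, hv⟩⟩
    · exact Or.inr ⟨⟨hj.1, hv⟩, ⟨hj.2, hu⟩⟩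
  · intro v
    exact ⟨sigma_ncard_le e d {i | v ∈ W i} (hW v) (fun i => {j | v ∈ A i j}) (fun i => (h3 i v).1),
      sigma_ncard_le e d {i | v ∈ W i} (hW v) (fun i => {j | v ∈ B i j}) (fun i => (h3 i v).2)⟩

/-- Union over an index set without any support information. -/
theorem BCov.union_univ {V : Type} {R G : V → V → Prop} {d n : ℕ}
    (Ri : Fin n → V → V → Prop) (h : ∀ i, BCov (Ri i) G d)
    (hR : ∀ u v, R u v → ∃ i, Ri i u v) : BCov R G (n * d) := by
  apply BCov.union (fun _ => Set.univ) _ Ri h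
  · intro u v huv
    obtain ⟨i, hi⟩ := hR u v huv
    exact ⟨i, trivial, trivial, hi⟩
  · intro v
    simp

theorem dyadic_count (N l : ℕ) (J : Set ℕ) (hJ : J.OrdConnected) :
    {j : Fin N | (∃ i ∈ J, i / 2 ^ l = (j : ℕ)) ∧
      ¬ ∀ i : ℕ, i / 2 ^ l / 2 = (j : ℕ) / 2 → i ∈ J}.ncard ≤ 4 := by
  classical
  set M := {j : Fin N | (∃ i ∈ J, i / 2 ^ l = (j : ℕ)) ∧
      ¬ ∀ i : ℕ, i / 2 ^ l / 2 = (j : ℕ) / 2 → i ∈ J} with hM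
  have hfin : ((fun j : Fin N => (j : ℕ)) '' M).Finite := Set.toFinite _
  rw [← Set.ncard_image_of_injective M Fin.val_injective]
  rcases M.eq_empty_or_nonempty with h | ⟨j0, hj0⟩
  · simp [h]
  have hne : hfin.toFinset.Nonempty := ⟨j0, (Set.Finite.mem_toFinset _).2 ⟨j0, hj0, rfl⟩⟩
  obtain ⟨m, hm, hmin⟩ := hfin.toFinset.exists_min_image id hne
  obtain ⟨X, hX, hmax⟩ := hfin.toFinset.exists_max_image id hne
  have hsub : ((fun j : Fin N => (j : ℕ)) '' M) ⊆ (({m, m + 1, X - 1, X} : Finset ℕ) : Set ℕ) := by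
    intro j hj
    have h1 : m ≤ j := hmin j (by simpa using hj)
    have h2 : j ≤ X := hmax j (by simpa using hj)
    by_contra hcon
    simp at hcon
    obtain ⟨j', hj', rfl⟩ := hj
    apply hj'.2
    intro i hi
    obtain ⟨m', hm', rfl⟩ := (Set.Finite.mem_toFinset _).1 hm
    obtain ⟨X', hX', rfl⟩ := (Set.Finite.mem_toFinset _).1 hX
    obtain ⟨i0, hi0, hi0'⟩ := hm'.1
    obtain ⟨i1, hi1, hi1'⟩ := hX'.1
    apply hJ.out hi0 hi1
    constructor
    · by_contra hlt
      have := Nat.div_le_div_right (c := 2 ^ l) (le_of_not_ge hlt)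
      simp only at *
      omega
    · by_contra hlt
      have := Nat.div_le_div_right (c := 2 ^ l) (le_of_not_ge hlt)
      simp only at *
      omega
  calc _ ≤ _ := Set.ncard_le_ncard hsub
    _ = _ := Set.ncard_coe_finset _
    _ ≤ 4 := Finset.card_le_four

theorem BCov.tree {V : Type} {G : V → V → Prop} {d : ℕ} (h : ℕ) (J : V → Set ℕ)
    (hJ : ∀ v, (J v).OrdConnected) (R : ℕ → V → V → Prop) (hs : ∀ i u v, R i u v → R i v u)
    (hRJ : ∀ i u v, R i u v → i ∈ J u)
    (hc : ∀ l j, BCov (fun u v => (∀ i, i / 2 ^ l = j → i ∈ J u) ∧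
      ∃ i, i / 2 ^ l = j ∧ R i u v) G d) :
    BCov (fun u v => ∃ i < 2 ^ h, R i u v) G ((h + 1) * (4 * d)) := by
  let T : ℕ → V → V → Prop := fun l u v => ∃ i < 2 ^ h, R i u v ∧
    (∀ i', i' / 2 ^ l = i / 2 ^ l → i' ∈ J u) ∧
    (l < h → (¬ ∀ i', i' / 2 ^ l / 2 = i / 2 ^ l / 2 → i' ∈ J u) ∧
      (¬ ∀ i', i' / 2 ^ l / 2 = i / 2 ^ l / 2 → i' ∈ J v))
  apply BCov.union_univ (fun l : Fin (h + 1) => fun u v => T l u v ∨ T l v u)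
  · intro l
    refine BCov.mono_symm (R' := T l) ?_ (fun u v h => h)
    refine BCov.union (I := Fin (2 ^ h))
      (fun j => {v | (∃ i ∈ J v, i / 2 ^ (l : ℕ) = (j : ℕ)) ∧
        ((l : ℕ) < h → ¬ ∀ i' : ℕ, i' / 2 ^ (l : ℕ) / 2 = (j : ℕ) / 2 → i' ∈ J v) ∧ (¬ (l : ℕ) < h → (j : ℕ) = 0)}) ?_ _
        (fun j => hc l j) ?_
    · intro v
      by_cases hl : (l : ℕ) < h
      · refine le_trans (Set.ncard_le_ncard ?_) (dyadic_count (2 ^ h) l (J v) (hJ v))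
        intro j hj
        exact ⟨hj.1, hj.2.1 hl⟩
      · refine le_trans (Set.ncard_le_ncard (t := {⟨0, by positivity⟩}) ?_) (by simp)
        intro j hj
        exact Fin.ext (hj.2.2 hl)
    · rintro u v ⟨i, hi, hR, h1, h2⟩
      have hz : ¬ (l : ℕ) < h → i / 2 ^ (l : ℕ) = 0 := by
        intro hl
        have : (l : ℕ) = h := by omega
        rw [this]
        exact Nat.div_eq_of_lt hi
      refine ⟨⟨i / 2 ^ (l : ℕ), lt_of_le_of_lt (Nat.div_le_self _ _) hi⟩, ?_, ?_, ?_, ?_⟩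
      · exact ⟨⟨i, hRJ _ _ _ hR, rfl⟩, fun hl => (h2 hl).1, hz⟩
      · exact ⟨⟨i, hRJ _ _ _ (hs _ _ _ hR), rfl⟩, fun hl => (h2 hl).2, hz⟩
      · exact h1
      · exact ⟨i, rfl, hR⟩
  · rintro u v ⟨i, hi, hR⟩
    classical
    let Pr : ℕ → Prop := fun l => (∀ i', i' / 2 ^ l = i / 2 ^ l → i' ∈ J u) ∨
      (∀ i', i' / 2 ^ l = i / 2 ^ l → i' ∈ J v)
    have h0 : Pr 0 := by
      left
      intro i' hi'
      simp at hi'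
      rw [hi']
      exact hRJ _ _ _ hR
    set l := Nat.findGreatest Pr h with hl
    have hPl : Pr l := Nat.findGreatest_spec (Nat.zero_le h) h0
    have hle : l ≤ h := Nat.findGreatest_le h
    have hnot : l < h → ¬ Pr (l + 1) := fun hlt =>
      Nat.findGreatest_is_greatest (Nat.lt_succ_self _) hlt
    have hnot' : l < h → (¬ ∀ i', i' / 2 ^ l / 2 = i / 2 ^ l / 2 → i' ∈ J u) ∧
      (¬ ∀ i', i' / 2 ^ l / 2 = i / 2 ^ l / 2 → i' ∈ J v) := by
      intro hlt
      have := hnot hlt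
      simp only [Pr, not_or, pow_succ, ← Nat.div_div_eq_div_mul] at this
      exact this
    refine ⟨⟨l, by omega⟩, ?_⟩
    rcases hPl with h1 | h1
    · exact Or.inl ⟨i, hi, hR, h1, hnot'⟩
    · exact Or.inr ⟨i, hi, hs _ _ _ hR, h1, fun hlt => (hnot' hlt).symm⟩

theorem BCov.chain {V : Type} [Fintype V] {G : V → V → Prop} (h : ℕ) (hV : Fintype.card V ≤ 2 ^ h)
    (r : V → V → Prop)
    (htr : ∀ a b c, r a b → r b c → r a c) (hir : ∀ a, ¬ r a a) (K : Set V)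
    (hK : ∀ u ∈ K, ∀ v ∈ K, u = v ∨ r u v ∨ r v u) (M : V → V → Prop)
    (hMK : ∀ c ∈ K, ∀ t, M c t → t ∉ K) (hMG : ∀ c t, M c t → G c t)
    (hbet : ∀ c₁ ∈ K, ∀ c ∈ K, ∀ c₂ ∈ K, ∀ t ∉ K, M c₁ t → M c₂ t → r c₁ c → r c c₂ → G c t) :
    BCov (fun u v => u ∈ K ∧ M u v) G ((h + 1) * (4 * 1)) := by
  classical
  let pos : V → ℕ := fun u => {w | w ∈ K ∧ r w u}.ncard
  have hposlt : ∀ u, pos u < 2 ^ h := by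
    intro u
    refine lt_of_lt_of_le ?_ hV
    rw [← Nat.card_eq_fintype_card, ← Set.ncard_univ]
    refine Set.ncard_lt_ncard ⟨Set.subset_univ _, fun hh => ?_⟩ (Set.toFinite _)
    exact hir u (hh (Set.mem_univ u)).2
  have hposr : ∀ u ∈ K, ∀ v, r u v → pos u < pos v := by
    intro u hu v huv
    refine Set.ncard_lt_ncard ⟨fun w hw => ⟨hw.1, htr _ _ _ hw.2 huv⟩, fun hh => ?_⟩ (Set.toFinite _)
    have : u ∈ {w | w ∈ K ∧ r w u} := hh ⟨hu, huv⟩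
    exact hir u this.2
  have hle : ∀ u ∈ K, ∀ v ∈ K, pos u ≤ pos v → u = v ∨ r u v := by
    intro u hu v hv huv
    rcases hK u hu v hv with h | h | h
    · exact Or.inl h
    · exact Or.inr h
    · have := hposr v hv u h
      omega
  let J : V → Set ℕ := fun v => if v ∈ K then {pos v} else
    {p | ∃ c₁ ∈ K, ∃ c₂ ∈ K, M c₁ v ∧ M c₂ v ∧ pos c₁ ≤ p ∧ p ≤ pos c₂}
  have hJK : ∀ v ∈ K, J v = {pos v} := fun v hv => by simp [J, hv]
  have hJn : ∀ v, v ∉ K → J v =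
    {p | ∃ c₁ ∈ K, ∃ c₂ ∈ K, M c₁ v ∧ M c₂ v ∧ pos c₁ ≤ p ∧ p ≤ pos c₂} :=
    fun v hv => by simp [J, hv]
  have hMJ : ∀ c ∈ K, ∀ t, M c t → pos c ∈ J t := by
    intro c hc t hM
    rw [hJn t (hMK c hc t hM)]
    exact ⟨c, hc, c, hc, hM, hM, le_rfl, le_rfl⟩
  let R : ℕ → V → V → Prop := fun i u v => (u ∈ K ∧ M u v ∧ i = pos u) ∨ (v ∈ K ∧ M v u ∧ i = pos v)
  have key : BCov (fun u v => ∃ i < 2 ^ h, R i u v) G ((h + 1) * (4 * 1)) := by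
    apply BCov.tree h J
    · intro v
      by_cases hv : v ∈ K
      · rw [hJK v hv]; exact Set.ordConnected_singleton
      · rw [hJn v hv]
        constructor
        rintro p ⟨c₁, h1, c₂, h2, h3, h4, h5, h6⟩ q ⟨e₁, g1, e₂, g2, g3, g4, g5, g6⟩ z hz
        exact ⟨c₁, h1, e₂, g2, h3, g4, h5.trans hz.1, hz.2.trans g6⟩
    · intro i u v hR
      exact hR.symm
    · rintro i u v (⟨hu, hM, rfl⟩ | ⟨hv, hM, rfl⟩)
      · rw [hJK u hu]; rfl
      · exact hMJ v hv u hM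
    · intro l j
      refine ⟨Unit, inferInstance, fun _ => {c | c ∈ K ∧ pos c / 2 ^ l = j},
        fun _ => {t | t ∉ K ∧ ∀ i, i / 2 ^ l = j → i ∈ J t}, ?_, ?_, ?_⟩
      · rintro _ c ⟨hc, hcj⟩ t ⟨ht, htJ⟩
        have h1 := htJ _ hcj
        rw [hJn t ht] at h1
        obtain ⟨c₁, h1, c₂, h2, h3, h4, h5, h6⟩ := h1
        rcases hle c₁ h1 c hc h5 with rfl | h7
        · exact hMG _ _ h3
        rcases hle c hc c₂ h2 h6 with rfl | h8
        · exact hMG _ _ h4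
        exact hbet c₁ h1 c hc c₂ h2 t ht h3 h4 h7 h8
      · rintro u v ⟨h1, i, hi, ⟨hu, hM, rfl⟩ | ⟨hv, hM, rfl⟩⟩
        · refine ⟨(), Or.inl ⟨⟨hu, hi⟩, ⟨hMK u hu v hM, ?_⟩⟩⟩
          intro i' hi'
          have h2 := h1 i' hi'
          rw [hJK u hu] at h2
          rw [Set.mem_singleton_iff.1 h2]
          exact hMJ u hu v hM
        · exact ⟨(), Or.inr ⟨⟨hv, hi⟩, ⟨hMK v hv u hM, h1⟩⟩⟩
      · intro v
        constructor <;> exact le_trans (Set.ncard_le_card _) (by simp)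
  refine key.mono_symm ?_
  rintro u v ⟨hu, hM⟩
  exact Or.inl ⟨pos u, hposlt u, Or.inl ⟨hu, hM, rfl⟩⟩

/-- Two convex planar sets that swap vertical order between two vertical lines meet. -/
theorem convex_cross {A B : Set (ℝ × ℝ)} (hA : Convex ℝ A) (hB : Convex ℝ B)
    {x x' y z y' z' : ℝ} (h1 : (x, y) ∈ A) (h2 : (x', z) ∈ A) (h3 : (x, y') ∈ B)
    (h4 : (x', z') ∈ B) (h5 : y' ≤ y) (h6 : z ≤ z') : (A ∩ B).Nonempty := by
  by_cases hd : (y - y') + (z' - z) = 0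
  · have : y = y' := by linarith
    subst this
    exact ⟨_, h1, h3⟩
  have hpos : 0 < (y - y') + (z' - z) := lt_of_le_of_ne (by linarith) (Ne.symm hd)
  set a := (z' - z) / ((y - y') + (z' - z)) with ha
  set b := (y - y') / ((y - y') + (z' - z)) with hb
  have ha0 : 0 ≤ a := div_nonneg (by linarith) hpos.le
  have hb0 : 0 ≤ b := div_nonneg (by linarith) hpos.le
  have hab : a + b = 1 := by rw [ha, hb]; field_simp; ring
  refine ⟨a • (x, y) + b • (x', z), hA h1 h2 ha0 hb0 hab, ?_⟩
  have : a • (x, y) + b • (x', z) = a • (x, y') + b • (x', z') := by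
    ext
    · simp
    · simp only [Prod.snd_add, Prod.smul_snd, smul_eq_mul]
      rw [ha, hb]; field_simp; ring
  rw [this]
  exact hB h3 h4 ha0 hb0 hab

theorem BCov.node {V : Type} [Fintype V] (F : V → Set (ℝ × ℝ)) (hF : ∀ v, Convex ℝ (F v)) (k : ℕ)
    (hk : ∀ T : Finset V, T.card = k → ¬ ∀ s ∈ T, ∀ t ∈ T, (F s ∩ F t).Nonempty)
    (h : ℕ) (hV : Fintype.card V ≤ 2 ^ h) (x : ℕ → ℝ) (D : Set ℕ) (hD : D.Nonempty) :
    BCov (fun u v => (∀ i ∈ D, ∃ y, (x i, y) ∈ F u) ∧ u ≠ v ∧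
        ∃ i ∈ D, ∃ y, (x i, y) ∈ F u ∧ (x i, y) ∈ F v)
      (fun u v => u ≠ v ∧ (F u ∩ F v).Nonempty) (k * ((h + 1) * (4 * 1))) := by
  classical
  obtain ⟨i0, hi0⟩ := hD
  let L : Set V := {u | ∀ i ∈ D, ∃ y, (x i, y) ∈ F u}
  let r : V → V → Prop := fun u v => u ∈ L ∧ v ∈ L ∧
    ∀ i ∈ D, ∀ y y', (x i, y) ∈ F u → (x i, y') ∈ F v → y < y'
  have htr : ∀ a b c, r a b → r b c → r a c := by
    rintro a b c ⟨h1, h2, h3⟩ ⟨h4, h5, h6⟩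
    refine ⟨h1, h5, fun i hi y y' hy hy' => ?_⟩
    obtain ⟨z, hz⟩ := h2 i hi
    exact (h3 i hi _ _ hy hz).trans (h6 i hi _ _ hz hy')
  have hir : ∀ a, ¬ r a a := by
    rintro a ⟨h1, _, h3⟩
    obtain ⟨z, hz⟩ := h1 i0 hi0
    exact lt_irrefl _ (h3 i0 hi0 _ _ hz hz)
  have hinc : ∀ a ∈ L, ∀ b ∈ L, ¬ r a b → ¬ r b a → (F a ∩ F b).Nonempty := by
    intro a ha b hb h1 h2
    simp only [r, ha, hb, true_and, not_forall, not_lt] at h1 h2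
    obtain ⟨i, hi, y, y', hy, hy', hyy⟩ := h1
    obtain ⟨j, hj, z, z', hz, hz', hzz⟩ := h2
    exact convex_cross (hF a) (hF b) hy hz' hy' hz hyy hzz
  obtain ⟨f, hf1, hf2⟩ := dilworth_aux r htr hir _ L.toFinset k rfl (by
    intro T hT hanti
    by_contra hcon
    obtain ⟨T', hT', hc⟩ := Finset.exists_subset_card_eq (le_of_not_ge hcon)
    refine hk T' hc fun s hs t ht => ?_
    have hsL : s ∈ L := by simpa using hT (hT' hs)
    have htL : t ∈ L := by simpa using hT (hT' ht)
    exact hinc s hsL t htL (hanti _ (hT' hs) _ (hT' ht)) (hanti _ (hT' ht) _ (hT' hs)))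
  let M : V → V → Prop := fun u v => u ≠ v ∧ ∃ i ∈ D, ∃ y, (x i, y) ∈ F u ∧ (x i, y) ∈ F v
  refine BCov.union_univ (fun q : Fin k => fun u v => u ∈ {u | u ∈ L ∧ f u = q} ∧ M u v) ?_ ?_
  · intro q
    have hKK : ∀ u ∈ {u | u ∈ L ∧ f u = q}, ∀ v ∈ {u | u ∈ L ∧ f u = q}, u = v ∨ r u v ∨ r v u := by
      rintro u ⟨hu, huq⟩ v ⟨hv, hvq⟩
      exact hf2 u (by simpa using hu) v (by simpa using hv) (huq.trans hvq.symm)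
    apply BCov.chain h hV r htr hir _ hKK
    · rintro c hc t ⟨hne, i, hi, y, hy, hy'⟩ htK
      rcases hKK c hc t htK with h1 | h1 | h1
      · exact hne h1
      · exact lt_irrefl _ (h1.2.2 i hi _ _ hy hy')
      · exact lt_irrefl _ (h1.2.2 i hi _ _ hy' hy)
    · rintro c t ⟨hne, i, hi, y, hy, hy'⟩
      exact ⟨hne, _, hy, hy'⟩
    · rintro c₁ h1 c hc c₂ h2 t ht ⟨_, i, hi, y, hy, hy'⟩ ⟨_, j, hj, z, hz, hz'⟩ hr1 hr2
      refine ⟨fun h => ht (h ▸ hc), ?_⟩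
      obtain ⟨p, hp⟩ := hc.1 i hi
      obtain ⟨p', hp'⟩ := hc.1 j hj
      exact convex_cross (hF c) (hF t) hp hp' hy' hz' (hr1.2.2 i hi _ _ hy hp).le
        (hr2.2.2 j hj _ _ hp' hz).le
  · rintro u v ⟨h1, h2⟩
    exact ⟨⟨f u, hf1 u (by simpa using (show u ∈ L from h1))⟩, ⟨h1, rfl⟩, h2⟩

theorem exists_enum (P : Finset ℝ) (hP : P.Nonempty) (N : ℕ) (hN : P.card ≤ N) :
    ∃ x : ℕ → ℝ, Monotone x ∧ ∀ p ∈ P, ∃ i < N, x i = p := by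
  have hpos : 0 < P.card := hP.card_pos
  refine ⟨fun i => P.orderEmbOfFin rfl ⟨min i (P.card - 1), by omega⟩, ?_, ?_⟩
  · intro i j hij
    apply (P.orderEmbOfFin rfl).monotone
    exact min_le_min_right _ hij
  · intro p hp
    have : p ∈ Set.range (P.orderEmbOfFin rfl) := by simpa using hp
    obtain ⟨i, rfl⟩ := this
    refine ⟨i, by omega, ?_⟩
    have : (⟨min (i : ℕ) (P.card - 1), by omega⟩ : Fin P.card) = i := by
      apply Fin.ext
      simp only
      omega
    simp only [this]

theorem BCov.main {V : Type} [Fintype V] [Nonempty V] (F : V → Set (ℝ × ℝ))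
    (hF : ∀ v, Convex ℝ (F v)) (k : ℕ)
    (hk : ∀ T : Finset V, T.card = k → ¬ ∀ s ∈ T, ∀ t ∈ T, (F s ∩ F t).Nonempty)
    (h : ℕ) (hV : Fintype.card V ^ 2 ≤ 2 ^ h) :
    BCov (fun u v => u ≠ v ∧ (F u ∩ F v).Nonempty)
      (fun u v => u ≠ v ∧ (F u ∩ F v).Nonempty) ((h + 1) * (4 * (k * ((h + 1) * (4 * 1))))) := by
  classical
  have hV' : Fintype.card V ≤ 2 ^ h := le_trans (Nat.le_self_pow (by norm_num) _) hV
  let g : V × V → ℝ := fun p => if hp : (F p.1 ∩ F p.2).Nonempty then hp.some.1 else 0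
  obtain ⟨x, hx, hxP⟩ := exists_enum (Finset.univ.image g) (Finset.univ_nonempty.image g) (2 ^ h) (by
    refine le_trans Finset.card_image_le (le_trans (le_of_eq ?_) hV)
    rw [Finset.card_univ, Fintype.card_prod, sq])
  let J : V → Set ℕ := fun v => {i | ∃ y, (x i, y) ∈ F v}
  let R : ℕ → V → V → Prop := fun i u v => u ≠ v ∧ ∃ y, (x i, y) ∈ F u ∧ (x i, y) ∈ F v
  have key := BCov.tree (G := fun u v => u ≠ v ∧ (F u ∩ F v).Nonempty)
    (d := k * ((h + 1) * (4 * 1))) h J (by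
      intro v
      constructor
      rintro i ⟨y, hy⟩ j ⟨z, hz⟩ m hm
      have hconv : Convex ℝ (Prod.fst '' F v) := (hF v).linear_image (LinearMap.fst ℝ ℝ ℝ)
      have := hconv.ordConnected.out (Set.mem_image_of_mem _ hy) (Set.mem_image_of_mem _ hz)
        ⟨hx hm.1, hx hm.2⟩
      obtain ⟨⟨a, b⟩, hab, he⟩ := this
      simp only at he
      exact ⟨b, he ▸ hab⟩) R
    (by rintro i u v ⟨h1, y, h2, h3⟩; exact ⟨h1.symm, y, h3, h2⟩)
    (by rintro i u v ⟨h1, y, h2, h3⟩; exact ⟨y, h2⟩)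
    (by
      intro l j
      refine (BCov.node F hF k hk h hV' x {i | i / 2 ^ l = j}
        ⟨j * 2 ^ l, Nat.mul_div_cancel _ (by positivity)⟩).mono_symm ?_
      rintro u v ⟨h1, i, hi, hne, y, hy⟩
      exact Or.inl ⟨h1, hne, i, hi, y, hy⟩)
  refine key.mono_symm ?_
  rintro u v ⟨hne, hm⟩
  left
  obtain ⟨i, hi, hxi⟩ := hxP (g (u, v)) (Finset.mem_image_of_mem _ (Finset.mem_univ _))
  refine ⟨i, hi, hne, hm.some.2, ?_⟩
  have : g (u, v) = hm.some.1 := by simp only [g]; rw [dif_pos hm]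
  rw [hxi, this]
  exact hm.some_mem

theorem log_bound (n : ℕ) (hn : 2 ≤ n) :
    ((2 * (Nat.log 2 n + 1) + 1 : ℕ) : ℝ) ≤ 10 * Real.log n := by
  have h2 : (0.5 : ℝ) < Real.log 2 := by have := Real.log_two_gt_d9; linarith
  have hle : Real.log 2 ≤ Real.log n := Real.log_le_log (by norm_num) (by exact_mod_cast hn)
  have h1 : (Nat.log 2 n : ℝ) * Real.log 2 ≤ Real.log n := by
    rw [← Real.log_pow]
    apply Real.log_le_log (by positivity)
    exact_mod_cast Nat.pow_log_le_self 2 (by omega)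
  have h3 : (0 : ℝ) ≤ Nat.log 2 n := by positivity
  push_cast
  nlinarith

theorem stmt4 (k : ℕ) (hk : 3 ≤ k) :
    ∃ C c : ℝ, 0 < C ∧ 0 < c ∧
      ∀ S : Finset (Set (ℝ × ℝ)), 2 ≤ S.card →
        (∀ s ∈ S, ∃ a b : ℝ × ℝ, a ≠ b ∧ s = segment ℝ a b) →
        (∀ T : Finset (Set (ℝ × ℝ)), T ⊆ S → T.card = k →
          ¬ ∀ s ∈ T, ∀ t ∈ T, (s ∩ t).Nonempty) →
        ∃ (m : ℕ) (A B : Fin m → Finset (Set (ℝ × ℝ))),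
          (∀ i, A i ⊆ S ∧ B i ⊆ S ∧ Disjoint (A i) (B i)) ∧
          (∀ i, ∀ a ∈ A i, ∀ b ∈ B i, a ≠ b ∧ (a ∩ b).Nonempty) ∧
          (∀ u ∈ S, ∀ v ∈ S, u ≠ v → (u ∩ v).Nonempty →
            ∃ i, (u ∈ A i ∧ v ∈ B i) ∨ (v ∈ A i ∧ u ∈ B i)) ∧
          ((∑ i, ((A i).card + (B i).card) : ℕ) : ℝ) ≤
              C * (S.card : ℝ) * Real.log (S.card : ℝ) ^ c ∧
          (∀ s ∈ S, ({i : Fin m | s ∈ A i}.ncard : ℝ) ≤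
              C * Real.log (S.card : ℝ) ^ c) ∧
          (∀ s ∈ S, ({i : Fin m | s ∈ B i}.ncard : ℝ) ≤
              C * Real.log (S.card : ℝ) ^ c) := by
  classical
  have hk0 : (0 : ℝ) < k := by exact_mod_cast (by omega : 0 < k)
  refine ⟨3200 * k, 2, by positivity, by norm_num, ?_⟩
  intro S hS hseg hfree
  have : Nonempty S := by
    obtain ⟨s, hs⟩ := Finset.card_pos.1 (by omega : 0 < S.card)
    exact ⟨⟨s, hs⟩⟩
  set h := 2 * (Nat.log 2 S.card + 1) with hh
  have hmain := BCov.main (V := S) (fun v => (v : Set (ℝ × ℝ))) (by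
      rintro ⟨v, hv⟩
      obtain ⟨a, b, _, rfl⟩ := hseg v hv
      exact convex_segment a b) k (by
      intro T hT hall
      refine hfree (T.image Subtype.val) ?_ ?_ ?_
      · intro s hs
        obtain ⟨v, _, rfl⟩ := Finset.mem_image.1 hs
        exact v.2
      · rw [Finset.card_image_of_injective _ Subtype.val_injective, hT]
      · intro s hs t ht
        obtain ⟨v, hv, rfl⟩ := Finset.mem_image.1 hs
        obtain ⟨w, hw, rfl⟩ := Finset.mem_image.1 ht
        exact hall v hv w hw) h (by
      rw [Fintype.card_coe, hh, pow_mul', ]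
      exact Nat.pow_le_pow_left (Nat.lt_pow_succ_log_self (by norm_num) _).le 2)
  obtain ⟨ι, hι, A, B, h1, h2, h3⟩ := hmain
  set d := (h + 1) * (4 * (k * ((h + 1) * (4 * 1)))) with hd
  have hdle : (d : ℝ) ≤ 1600 * k * Real.log S.card ^ 2 := by
    have hlog := log_bound S.card hS
    rw [← hh] at hlog
    have hsq : ((h + 1 : ℕ) : ℝ) ^ 2 ≤ (10 * Real.log S.card) ^ 2 :=
      pow_le_pow_left₀ (by positivity) hlog 2
    have : (d : ℝ) = 16 * k * ((h + 1 : ℕ) : ℝ) ^ 2 := by rw [hd]; push_cast; ring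
    rw [this]
    calc 16 * (k : ℝ) * ((h + 1 : ℕ) : ℝ) ^ 2 ≤ 16 * k * (10 * Real.log S.card) ^ 2 := by gcongr
      _ = _ := by ring
  have hsqn : (0 : ℝ) ≤ k * Real.log S.card ^ 2 := by positivity
  obtain ⟨m, ⟨e⟩⟩ := Finite.exists_equiv_fin ι
  let A' : Fin m → Finset (Set (ℝ × ℝ)) := fun i => (A (e.symm i)).toFinset.image Subtype.val
  let B' : Fin m → Finset (Set (ℝ × ℝ)) := fun i => (B (e.symm i)).toFinset.image Subtype.val
  have hmA : ∀ i (v : S), (v : Set (ℝ × ℝ)) ∈ A' i ↔ v ∈ A (e.symm i) := by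
    intro i v; simp [A']
  have hmB : ∀ i (v : S), (v : Set (ℝ × ℝ)) ∈ B' i ↔ v ∈ B (e.symm i) := by
    intro i v; simp [B']
  have hAS : ∀ i, A' i ⊆ S := by
    intro i s hs
    obtain ⟨v, _, rfl⟩ := Finset.mem_image.1 hs
    exact v.2
  have hBS : ∀ i, B' i ⊆ S := by
    intro i s hs
    obtain ⟨v, _, rfl⟩ := Finset.mem_image.1 hs
    exact v.2
  have hG : ∀ i, ∀ a ∈ A' i, ∀ b ∈ B' i, a ≠ b ∧ (a ∩ b).Nonempty := by
    intro i a ha b hb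
    have := h1 (e.symm i) ⟨a, hAS i ha⟩ ((hmA i ⟨a, hAS i ha⟩).1 ha)
      ⟨b, hBS i hb⟩ ((hmB i ⟨b, hBS i hb⟩).1 hb)
    exact ⟨fun h => this.1 (Subtype.ext h), this.2⟩
  have hcA : ∀ s ∈ S, {i : Fin m | s ∈ A' i}.ncard ≤ d := by
    intro s hs
    refine le_trans (le_of_eq ?_) (h3 ⟨s, hs⟩).1
    rw [← Set.ncard_image_of_injective _ e.symm.injective]
    congr 1
    ext j
    constructor
    · rintro ⟨i, hi, rfl⟩
      exact (hmA i ⟨s, hs⟩).1 hi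
    · intro hj
      exact ⟨e j, (hmA (e j) ⟨s, hs⟩).2 (by simpa using hj), by simp⟩
  have hcB : ∀ s ∈ S, {i : Fin m | s ∈ B' i}.ncard ≤ d := by
    intro s hs
    refine le_trans (le_of_eq ?_) (h3 ⟨s, hs⟩).2
    rw [← Set.ncard_image_of_injective _ e.symm.injective]
    congr 1
    ext j
    constructor
    · rintro ⟨i, hi, rfl⟩
      exact (hmB i ⟨s, hs⟩).1 hi
    · intro hj
      exact ⟨e j, (hmB (e j) ⟨s, hs⟩).2 (by simpa using hj), by simp⟩
  have hsum : ∀ X : Fin m → Finset (Set (ℝ × ℝ)), (∀ i, X i ⊆ S) →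
      (∀ s ∈ S, {i : Fin m | s ∈ X i}.ncard ≤ d) → ∑ i, (X i).card ≤ S.card * d := by
    intro X hXS hX
    have e1 : ∀ i, (X i).card = ∑ s ∈ S, if s ∈ X i then 1 else 0 := by
      intro i
      rw [← Finset.sum_filter, Finset.sum_const, smul_eq_mul, mul_one]
      congr 1
      ext s
      simp only [Finset.mem_filter]
      exact ⟨fun h => ⟨hXS i h, h⟩, fun h => h.2⟩
    rw [Finset.sum_congr rfl (fun i _ => e1 i), Finset.sum_comm]
    calc _ ≤ ∑ s ∈ S, d := by
          apply Finset.sum_le_sum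
          intro s hs
          refine le_trans (le_of_eq ?_) (hX s hs)
          rw [Set.ncard_eq_toFinset_card', ← Finset.sum_filter, Finset.sum_const, smul_eq_mul, mul_one]
          congr 1
          ext i; simp
      _ = S.card * d := by simp
  have hfin : ∀ c : ℕ, c ≤ d → (c : ℝ) ≤ 3200 * k * Real.log (S.card : ℝ) ^ (2 : ℝ) := by
    intro c hc
    have : (c : ℝ) ≤ d := by exact_mod_cast hc
    rw [Real.rpow_two]
    nlinarith
  refine ⟨m, A', B', ?_, hG, ?_, ?_, fun s hs => hfin _ (hcA s hs), fun s hs => hfin _ (hcB s hs)⟩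
  · intro i
    refine ⟨hAS i, hBS i, ?_⟩
    rw [Finset.disjoint_left]
    intro a ha hb
    exact (hG i a ha a hb).1 rfl
  · intro u hu v hv hne hm
    obtain ⟨i, hi⟩ := h2 ⟨u, hu⟩ ⟨v, hv⟩ ⟨fun h => hne (congrArg Subtype.val h), hm⟩
    refine ⟨e i, ?_⟩
    have a1 := hmA (e i) ⟨u, hu⟩
    have a2 := hmA (e i) ⟨v, hv⟩
    have b1 := hmB (e i) ⟨u, hu⟩
    have b2 := hmB (e i) ⟨v, hv⟩
    simp only [Equiv.symm_apply_apply] at a1 a2 b1 b2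
    rw [a1, a2, b1, b2]
    exact hi
  · have t1 := hsum A' hAS hcA
    have t2 := hsum B' hBS hcB
    have t3 : ∑ i, ((A' i).card + (B' i).card) ≤ 2 * (S.card * d) := by
      rw [Finset.sum_add_distrib]; omega
    have t4 : ((∑ i, ((A' i).card + (B' i).card) : ℕ) : ℝ) ≤ ((2 * (S.card * d) : ℕ) : ℝ) := by
      exact_mod_cast t3
    refine t4.trans ?_
    rw [Real.rpow_two]
    push_cast
    have : (S.card : ℝ) * d ≤ S.card * (1600 * k * Real.log S.card ^ 2) := by gcongr
    nlinarith
end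

section
/- For every integer k ≥ 1 there exist constants C > 0 and c > 0 with the following property. Let S be a finite set of n ≥ 2 closed line segments in ℝ² (each segment being the convex hull of two distinct points) such that there do NOT exist two disjoint k-element subsets A, B ⊆ S with every segment of A intersecting every segment of B. Then the number of unordered pairs {s, s'} of distinct segments of S with s ∩ s' ≠ ∅ is at most C·n·(log n)^c. -/
lemma aux_card1 {ι : Type*} (L W : Finset ι) (P : ι → ι → Prop)
    [DecidablePred fun p : ι × ι => P p.1 p.2] [∀ s t, Decidable (P s t)] :
    ((L ×ˢ W).filter (fun p => P p.1 p.2)).card = ∑ s ∈ L, (W.filter (fun t => P s t)).card := by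
  simp only [Finset.card_filter, Finset.sum_product]

lemma aux_card2 {ι : Type*} (L W : Finset ι) (P : ι → ι → Prop)
    [DecidablePred fun p : ι × ι => P p.1 p.2] [∀ s t, Decidable (P s t)] :
    ((L ×ˢ W).filter (fun p => P p.1 p.2)).card = ∑ t ∈ W, (L.filter (fun s => P s t)).card := by
  simp only [Finset.card_filter, Finset.sum_product_right]

open Classical in
lemma interval_count {ι : Type*} (k : ℕ) (L W : Finset ι) (g : ι → ℝ)
    (N : ι → ι → Prop)
    (conv : ∀ t ∈ W, ∀ s ∈ L, ∀ u ∈ L, ∀ v ∈ L, g s ≤ g u → g u ≤ g v → N s t → N v t → N u t)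
    (free : ∀ A ⊆ L, ∀ B ⊆ W, A.card = k → B.card = k → ¬ ∀ a ∈ A, ∀ b ∈ B, N a b) :
    ((L ×ˢ W).filter (fun p => N p.1 p.2)).card ≤ k * (L.card + W.card) := by
  set U : ι → ι → Finset ι := fun s t => L.filter (fun u => N u t ∧ g s ≤ g u) with hU
  have hsub : (L ×ˢ W).filter (fun p => N p.1 p.2) ⊆
      ((L ×ˢ W).filter (fun p => N p.1 p.2 ∧ k ≤ (U p.1 p.2).card)) ∪
      ((L ×ˢ W).filter (fun p => N p.1 p.2 ∧ (U p.1 p.2).card < k)) := by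
    intro p hp
    simp only [Finset.mem_union, Finset.mem_filter] at hp ⊢
    rcases le_or_gt k (U p.1 p.2).card with h | h
    · left; exact ⟨hp.1, hp.2, h⟩
    · right; exact ⟨hp.1, hp.2, h⟩
  have h1 : ((L ×ˢ W).filter (fun p => N p.1 p.2 ∧ k ≤ (U p.1 p.2).card)).card ≤ L.card * k := by
    rw [aux_card1 L W (fun s t => N s t ∧ k ≤ (U s t).card)]
    refine Finset.sum_le_card_nsmul _ _ _ ?_
    intro s hs
    by_contra hcon
    push Not at hcon
    obtain ⟨B, hB, hBk⟩ := Finset.exists_subset_card_eq hcon.le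
    have hBmem : ∀ t ∈ B, t ∈ W ∧ N s t ∧ k ≤ (U s t).card := by
      intro t ht
      simpa using hB ht
    rcases B.eq_empty_or_nonempty with hBe | hBne
    · subst hBe
      simp at hBk
      subst hBk
      exact free ∅ (by simp) ∅ (by simp) rfl rfl (by simp)
    · obtain ⟨t, ht, hmin⟩ := Finset.exists_min_image B (fun t => (U s t).card) hBne
      obtain ⟨A, hA, hAk⟩ := Finset.exists_subset_card_eq (hBmem t ht).2.2
      refine free A (hA.trans (Finset.filter_subset _ _)) B (fun t ht => (hBmem t ht).1) hAk hBk ?_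
      intro u hu t' ht'
      by_contra hN
      have huU : u ∈ L ∧ N u t ∧ g s ≤ g u := by simpa [hU] using hA hu
      have hss : U s t' ⊂ U s t := by
        rw [Finset.ssubset_iff_of_subset]
        · exact ⟨u, hA hu, by simp [hU, hN]⟩
        · intro v hv
          have hv' : v ∈ L ∧ N v t' ∧ g s ≤ g v := by simpa [hU] using hv
          have hvu : g v < g u := by
            by_contra hc
            push Not at hc
            exact hN (conv t' (hBmem t' ht').1 s hs u huU.1 v hv'.1 huU.2.2 hc
              (hBmem t' ht').2.1 hv'.2.1)
          have := conv t (hBmem t ht).1 s hs v hv'.1 u huU.1 hv'.2.2 hvu.le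
            (hBmem t ht).2.1 huU.2.1
          simp [hU, hv'.1, this, hv'.2.2]
      have := Finset.card_lt_card hss
      have := hmin t' ht'
      omega
  have h2 : ((L ×ˢ W).filter (fun p => N p.1 p.2 ∧ (U p.1 p.2).card < k)).card ≤ W.card * k := by
    rw [aux_card2 L W (fun s t => N s t ∧ (U s t).card < k)]
    refine Finset.sum_le_card_nsmul _ _ _ ?_
    intro t ht
    rcases (L.filter (fun s => N s t ∧ (U s t).card < k)).eq_empty_or_nonempty with he | hne
    · rw [he]; simp
    · obtain ⟨s, hs, hmin⟩ := Finset.exists_min_image _ g hne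
      have hs' : s ∈ L ∧ N s t ∧ (U s t).card < k := by simpa using hs
      refine le_trans (Finset.card_le_card ?_) hs'.2.2.le
      intro u hu
      have hu' : u ∈ L ∧ N u t ∧ (U u t).card < k := by simpa using hu
      simp [hU, hu'.1, hu'.2.1, hmin u hu]
  calc _ ≤ _ := Finset.card_le_card hsub
    _ ≤ _ := Finset.card_union_le _ _
    _ ≤ L.card * k + W.card * k := by omega
    _ = _ := by ring

/-- The two partial affine functions meet above a point of `I`. -/
def Mt {ι : Type*} (l r a b : ι → ℝ) (I : Set ℝ) (s t : ι) : Prop :=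
  ∃ x ∈ I, l s ≤ x ∧ x ≤ r s ∧ l t ≤ x ∧ x ≤ r t ∧ a s * x + b s = a t * x + b t

lemma Mt.symm {ι : Type*} {l r a b : ι → ℝ} {I : Set ℝ} {s t : ι} (h : Mt l r a b I s t) :
    Mt l r a b I t s := by
  obtain ⟨x, hx, h1, h2, h3, h4, h5⟩ := h
  exact ⟨x, hx, h3, h4, h1, h2, h5.symm⟩

lemma Mt.mono {ι : Type*} {l r a b : ι → ℝ} {I J : Set ℝ} (hIJ : I ⊆ J) {s t : ι}
    (h : Mt l r a b I s t) : Mt l r a b J s t := by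
  obtain ⟨x, hx, h1⟩ := h
  exact ⟨x, hIJ hx, h1⟩

/-- Two affine functions whose order switches between `x` and `y` agree in between. -/
lemma aff_ivt (a b c d x y : ℝ) (hx : a * x + b ≤ c * x + d) (hy : c * y + d ≤ a * y + b) :
    ∃ z ∈ Set.uIcc x y, a * z + b = c * z + d := by
  have hc : ContinuousOn (fun z : ℝ => (a * z + b) - (c * z + d)) (Set.uIcc x y) := by fun_prop
  have := intermediate_value_uIcc hc
  have h0 : (0 : ℝ) ∈ Set.uIcc ((a * x + b) - (c * x + d)) ((a * y + b) - (c * y + d)) := by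
    rw [Set.mem_uIcc]; left; constructor <;> linarith
  obtain ⟨z, hz, hz0⟩ := this h0
  exact ⟨z, hz, by simp only at hz0; linarith⟩

/-- Transitivity of the crossing relation for lines sorted by slope. -/
lemma cross_trans {a1 b1 a2 b2 a3 b3 : ℝ} {I : Set ℝ} (hI : I.OrdConnected)
    (h12 : a1 ≤ a2) (h23 : a2 ≤ a3)
    (c12 : ∃ x ∈ I, a1 * x + b1 = a2 * x + b2) (c23 : ∃ x ∈ I, a2 * x + b2 = a3 * x + b3) :
    ∃ x ∈ I, a1 * x + b1 = a3 * x + b3 := by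
  obtain ⟨x, hx, ex⟩ := c12
  obtain ⟨y, hy, ey⟩ := c23
  rcases le_total x y with h | h
  · obtain ⟨z, hz, e⟩ := aff_ivt a1 b1 a3 b3 y x
      (by nlinarith [mul_nonneg (sub_nonneg.2 h12) (sub_nonneg.2 h)])
      (by nlinarith [mul_nonneg (sub_nonneg.2 h23) (sub_nonneg.2 h)])
    exact ⟨z, hI.uIcc_subset hy hx hz, e⟩
  · obtain ⟨z, hz, e⟩ := aff_ivt a1 b1 a3 b3 x y
      (by nlinarith [mul_nonneg (sub_nonneg.2 h23) (sub_nonneg.2 h)])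
      (by nlinarith [mul_nonneg (sub_nonneg.2 h12) (sub_nonneg.2 h)])
    exact ⟨z, hI.uIcc_subset hx hy hz, e⟩

open Classical in
/-- Mirsky-type colouring. -/
lemma mirsky {ι κ : Type*} [LinearOrder κ] (L : Finset ι) (key : ι → κ) (hkey : Set.InjOn key L)
    (R : ι → ι → Prop) (hsymm : ∀ s t, R s t → R t s)
    (htr : ∀ s ∈ L, ∀ t ∈ L, ∀ u ∈ L, key s ≤ key t → key t ≤ key u → R s t → R t u → R s u)
    (m : ℕ) (hcl : ∀ Q ⊆ L, (∀ s ∈ Q, ∀ t ∈ Q, s ≠ t → R s t) → Q.card < m) :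
    ∃ c : ι → ℕ, (∀ s, c s < m) ∧ ∀ s ∈ L, ∀ t ∈ L, s ≠ t → c s = c t → ¬ R s t := by
  have hm : 0 < m := by simpa using hcl ∅ (by simp) (by simp)
  let F : ι → Finset (Finset ι) := fun s => L.powerset.filter (fun Q =>
    (∀ s ∈ Q, ∀ t ∈ Q, s ≠ t → R s t) ∧ s ∈ Q ∧ ∀ q ∈ Q, key q ≤ key s)
  let c : ι → ℕ := fun s => (F s).sup Finset.card
  have hF : ∀ s Q, Q ∈ F s ↔ Q ⊆ L ∧ (∀ s ∈ Q, ∀ t ∈ Q, s ≠ t → R s t) ∧ s ∈ Q ∧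
      ∀ q ∈ Q, key q ≤ key s := by intro s Q; simp [F]
  have hlt : ∀ s ∈ L, ∀ t ∈ L, key s < key t → R s t → c s < c t := by
    intro s hs t ht hst hR
    have hne : (F s).Nonempty := ⟨{s}, by rw [hF]; simp [hs]⟩
    obtain ⟨Q, hQ, hQc⟩ := Finset.exists_mem_eq_sup (F s) hne Finset.card
    obtain ⟨q1, q2, q3, q4⟩ := (hF s Q).1 hQ
    have htQ : t ∉ Q := fun h => absurd (q4 t h) (not_le.2 hst)
    have hqt : ∀ q ∈ Q, R q t := by
      intro q hq
      by_cases hqs : q = s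
      · rw [hqs]; exact hR
      · exact htr q (q1 hq) s hs t ht (q4 q hq) hst.le (q2 q hq s q3 hqs) hR
    have hmem : insert t Q ∈ F t := by
      rw [hF]
      refine ⟨Finset.insert_subset ht q1, ?_, Finset.mem_insert_self _ _, ?_⟩
      · intro x hx y hy hxy
        rw [Finset.mem_insert] at hx hy
        rcases hx with rfl | hx <;> rcases hy with rfl | hy
        · exact absurd rfl hxy
        · exact hsymm _ _ (hqt y hy)
        · exact hqt x hx
        · exact q2 x hx y hy hxy
      · intro q hq
        rw [Finset.mem_insert] at hq
        rcases hq with rfl | hq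
        · exact le_rfl
        · exact (q4 q hq).trans hst.le
    have : (insert t Q).card ≤ c t := Finset.le_sup (f := Finset.card) hmem
    rw [Finset.card_insert_of_notMem htQ] at this
    have : c s = Q.card := hQc
    omega
  refine ⟨c, ?_, ?_⟩
  · intro s
    rw [Finset.sup_lt_iff hm]
    intro Q hQ
    obtain ⟨q1, q2, -⟩ := (hF s Q).1 hQ
    exact hcl Q q1 q2
  · intro s hs t ht hst hc hR
    rcases lt_trichotomy (key s) (key t) with h | h | h
    · have := hlt s hs t ht h hR; omega
    · exact hst (hkey hs ht h)
    · have := hlt t ht s hs h (hsymm _ _ hR); omega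

/-- No complete bipartite subgraph. -/
def KFree {ι : Type*} (l r a b : ι → ℝ) (k : ℕ) (S : Finset ι) : Prop :=
  ∀ A ⊆ S, ∀ B ⊆ S, Disjoint A B → A.card = k → B.card = k →
    ¬ ∀ s ∈ A, ∀ t ∈ B, Mt l r a b Set.univ s t

open Classical in
/-- Pairs formed by a long segment and an arbitrary one. -/
lemma long_count {ι : Type*} (l r a b : ι → ℝ) (k : ℕ) (S L W : Finset ι) (hL : L ⊆ S)
    (hW : W ⊆ S) (hS : KFree l r a b k S) (I : Set ℝ) (hI : I.OrdConnected)
    (hlong : ∀ s ∈ L, ∀ x ∈ I, l s ≤ x ∧ x ≤ r s) :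
    ((L ×ˢ W).filter (fun p => p.1 ≠ p.2 ∧ Mt l r a b I p.1 p.2)).card ≤
      2 * k * (k * (L.card + W.card)) := by
  rcases I.eq_empty_or_nonempty with rfl | ⟨x0, hx0⟩
  · simp [Mt]
  let e : ι → ℕ := fun s => if h : s ∈ S then (S.equivFin ⟨s, h⟩ : ℕ) else 0
  have he : Set.InjOn e L := by
    intro s hs t ht h
    have h1 := hL hs
    have h2 := hL ht
    simp only [e, h1, h2, dif_pos] at h
    have := S.equivFin.injective (Fin.ext h)
    simpa using this
  have hMR : ∀ s ∈ L, ∀ t ∈ L, (∃ x ∈ I, a s * x + b s = a t * x + b t) → Mt l r a b I s t := by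
    rintro s hs t ht ⟨x, hx, h⟩
    exact ⟨x, hx, (hlong s hs x hx).1, (hlong s hs x hx).2, (hlong t ht x hx).1,
      (hlong t ht x hx).2, h⟩
  obtain ⟨c, hc, hcR⟩ := mirsky L (fun s => toLex (a s, e s))
    (by
      intro s hs t ht h
      have : (a s, e s) = (a t, e t) := h
      exact he hs ht (Prod.ext_iff.1 this).2)
    (fun s t => ∃ x ∈ I, a s * x + b s = a t * x + b t)
    (by rintro s t ⟨x, hx, h⟩; exact ⟨x, hx, h.symm⟩)
    (by
      intro s hs t ht u hu h1 h2 h3 h4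
      have h1' : a s ≤ a t := by
        rw [Prod.Lex.toLex_le_toLex] at h1
        rcases h1 with h | h
        · exact le_of_lt h
        · exact le_of_eq h.1
      have h2' : a t ≤ a u := by
        rw [Prod.Lex.toLex_le_toLex] at h2
        rcases h2 with h | h
        · exact le_of_lt h
        · exact le_of_eq h.1
      exact cross_trans hI h1' h2' h3 h4)
    (2 * k)
    (by
      intro Q hQ hcl
      by_contra hcon
      push Not at hcon
      obtain ⟨A, hA, hAk⟩ := Finset.exists_subset_card_eq (show k ≤ Q.card by omega)
      have : k ≤ (Q \ A).card := by
        rw [Finset.card_sdiff_of_subset hA]; omega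
      obtain ⟨B, hB, hBk⟩ := Finset.exists_subset_card_eq this
      have hdis : Disjoint A B := Finset.disjoint_of_subset_right hB Finset.disjoint_sdiff
      refine hS A (hA.trans (hQ.trans hL)) B
        (hB.trans (Finset.sdiff_subset.trans (hQ.trans hL))) hdis hAk hBk ?_
      intro s hs t ht
      have htQ : t ∈ Q := (Finset.mem_sdiff.1 (hB ht)).1
      refine (hMR s (hQ (hA hs)) t (hQ htQ) (hcl s (hA hs) t htQ ?_)).mono (Set.subset_univ _)
      rintro rfl
      exact (Finset.mem_sdiff.1 (hB ht)).2 hs)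
  have hsub : (L ×ˢ W).filter (fun p => p.1 ≠ p.2 ∧ Mt l r a b I p.1 p.2) ⊆
      (Finset.range (2 * k)).biUnion (fun i =>
        ((L.filter (fun s => c s = i)) ×ˢ (W \ L.filter (fun s => c s = i))).filter
          (fun p => Mt l r a b I p.1 p.2)) := by
    intro p hp
    simp only [Finset.mem_filter, Finset.mem_product] at hp
    simp only [Finset.mem_biUnion, Finset.mem_filter, Finset.mem_product, Finset.mem_sdiff,
      Finset.mem_range]
    refine ⟨c p.1, hc _, ⟨⟨hp.1.1, rfl⟩, hp.1.2, ?_⟩, hp.2.2⟩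
    rintro ⟨h1, h2⟩
    obtain ⟨x, hx, h⟩ := hp.2.2
    exact hcR p.1 hp.1.1 p.2 h1 hp.2.1 h2.symm ⟨x, hx, h.2.2.2.2⟩
  refine (Finset.card_le_card hsub).trans ?_
  refine (Finset.card_biUnion_le_card_mul _ _ (k * (L.card + W.card)) ?_).trans (by simp)
  intro i _
  set Li := L.filter (fun s => c s = i) with hLi
  have hLiL : Li ⊆ L := Finset.filter_subset _ _
  have hdisj : ∀ s ∈ Li, ∀ t ∈ Li, s ≠ t → ¬ ∃ x ∈ I, a s * x + b s = a t * x + b t := by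
    intro s hs t ht hst
    rw [hLi, Finset.mem_filter] at hs ht
    exact hcR s hs.1 t ht.1 hst (hs.2.trans ht.2.symm)
  have hord : ∀ s ∈ Li, ∀ t ∈ Li, a s * x0 + b s ≤ a t * x0 + b t → ∀ x ∈ I,
      a s * x + b s ≤ a t * x + b t := by
    intro s hs t ht h x hx
    by_cases hst : s = t
    · rw [hst]
    by_contra hcon
    push Not at hcon
    obtain ⟨z, hz, e⟩ := aff_ivt _ _ _ _ x0 x h hcon.le
    exact hdisj s hs t ht hst ⟨z, hI.uIcc_subset hx0 hx hz, e⟩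
  refine (interval_count k Li (W \ Li) (fun s => a s * x0 + b s) (Mt l r a b I) ?_ ?_).trans ?_
  · intro t ht s hs u hu v hv hsu huv hst hvt
    obtain ⟨x, hx, h1, h2, h3, h4, h5⟩ := hst
    obtain ⟨y, hy, g1, g2, g3, g4, g5⟩ := hvt
    have e1 := hord s hs u hu hsu x hx
    have e2 := hord u hu v hv huv y hy
    obtain ⟨z, hz, e⟩ := aff_ivt (a t) (b t) (a u) (b u) x y (by linarith) (by linarith)
    have hzI := hI.uIcc_subset hx hy hz
    have hzt : z ∈ Set.Icc (l t) (r t) :=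
      Set.ordConnected_Icc.uIcc_subset (Set.mem_Icc.2 ⟨h3, h4⟩) (Set.mem_Icc.2 ⟨g3, g4⟩) hz
    exact ⟨z, hzI, (hlong u (hLiL hu) z hzI).1, (hlong u (hLiL hu) z hzI).2, hzt.1, hzt.2, e.symm⟩
  · intro A hA B hB hAk hBk hAB
    refine hS A (hA.trans (hLiL.trans hL)) B (hB.trans (Finset.sdiff_subset.trans hW)) ?_ hAk hBk ?_
    · exact Finset.disjoint_of_subset_left hA
        (Finset.disjoint_of_subset_right hB Finset.disjoint_sdiff)
    · intro s hs t ht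
      exact (hAB s hs t ht).mono (Set.subset_univ _)
  · have h1 := Finset.card_le_card hLiL
    have h2 := Finset.card_le_card (Finset.sdiff_subset : W \ Li ⊆ W)
    gcongr

open Classical in
lemma dyadic {ι : Type*} (l r a b : ι → ℝ) (k : ℕ) (S : Finset ι) (hS : KFree l r a b k S)
    (idx : ℝ → ℕ) (hmono : Monotone idx)
    (hl : ∀ s ∈ S, ∀ x, idx (l s) ≤ idx x → l s ≤ x)
    (hr : ∀ s ∈ S, ∀ x, idx x ≤ idx (r s) → x ≤ r s) (d : ℕ) :
    ∀ (i : ℕ) (W : Finset ι), W ⊆ S →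
      ((W ×ˢ W).filter (fun p => p.1 ≠ p.2 ∧
        Mt l r a b {x | i ≤ idx x ∧ idx x < i + 2 ^ d} p.1 p.2)).card ≤
      8 * k ^ 2 * W.card + 2 * (8 * k ^ 2) * d *
        ((W.filter (fun s => i ≤ idx (l s) ∧ idx (l s) < i + 2 ^ d)).card +
         (W.filter (fun s => i ≤ idx (r s) ∧ idx (r s) < i + 2 ^ d)).card) := by
  -- the step shared by the base case and the induction step
  have key : ∀ (d i : ℕ) (W : Finset ι), W ⊆ S →
      ((W ×ˢ W).filter (fun p => p.1 ≠ p.2 ∧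
        Mt l r a b {x | i ≤ idx x ∧ idx x < i + 2 ^ d} p.1 p.2)).card ≤
      8 * k ^ 2 * W.card +
      (((W.filter (fun s => ¬ (idx (l s) ≤ i ∧ i + 2 ^ d ≤ idx (r s) + 1) ∧
          idx (l s) < i + 2 ^ d ∧ i ≤ idx (r s))) ×ˢ
        (W.filter (fun s => ¬ (idx (l s) ≤ i ∧ i + 2 ^ d ≤ idx (r s) + 1) ∧
          idx (l s) < i + 2 ^ d ∧ i ≤ idx (r s)))).filter (fun p => p.1 ≠ p.2 ∧
        Mt l r a b {x | i ≤ idx x ∧ idx x < i + 2 ^ d} p.1 p.2)).card := by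
    intro d i W hW
    set I : Set ℝ := {x | i ≤ idx x ∧ idx x < i + 2 ^ d} with hIdef
    have hI : I.OrdConnected := by
      refine ⟨?_⟩
      intro x hx y hy z hz
      exact ⟨hx.1.trans (hmono hz.1), (hmono hz.2).trans_lt hy.2⟩
    set L := W.filter (fun s => idx (l s) ≤ i ∧ i + 2 ^ d ≤ idx (r s) + 1) with hLdef
    set V := W.filter (fun s => ¬ (idx (l s) ≤ i ∧ i + 2 ^ d ≤ idx (r s) + 1) ∧
          idx (l s) < i + 2 ^ d ∧ i ≤ idx (r s)) with hVdef
    have hLW : L ⊆ W := Finset.filter_subset _ _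
    have hlc := long_count l r a b k S L W (hLW.trans hW) hW hS I hI (by
      intro s hs x hx
      rw [hLdef, Finset.mem_filter] at hs
      exact ⟨hl s (hW hs.1) x (hs.2.1.trans hx.1), hr s (hW hs.1) x (by
        have := hx.2; have := hs.2.2; omega)⟩)
    set X := (L ×ˢ W).filter (fun p => p.1 ≠ p.2 ∧ Mt l r a b I p.1 p.2) with hX
    have hsub : (W ×ˢ W).filter (fun p => p.1 ≠ p.2 ∧ Mt l r a b I p.1 p.2) ⊆
        (X ∪ X.image Prod.swap) ∪
          (V ×ˢ V).filter (fun p => p.1 ≠ p.2 ∧ Mt l r a b I p.1 p.2) := by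
      rintro ⟨s, t⟩ hp
      simp only [Finset.mem_filter, Finset.mem_product] at hp
      obtain ⟨⟨hs, ht⟩, hne, hM⟩ := hp
      by_cases h1 : s ∈ L
      · refine Finset.mem_union_left _ (Finset.mem_union_left _ ?_)
        simp only [hX, Finset.mem_filter, Finset.mem_product]
        exact ⟨⟨h1, ht⟩, hne, hM⟩
      by_cases h2 : t ∈ L
      · refine Finset.mem_union_left _ (Finset.mem_union_right _ ?_)
        rw [Finset.mem_image]
        refine ⟨(t, s), ?_, rfl⟩
        simp only [hX, Finset.mem_filter, Finset.mem_product]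
        exact ⟨⟨h2, hs⟩, hne.symm, hM.symm⟩
      · refine Finset.mem_union_right _ ?_
        simp only [Finset.mem_filter, Finset.mem_product]
        obtain ⟨x, hx, q1, q2, q3, q4, -⟩ := id hM
        refine ⟨⟨?_, ?_⟩, hne, hM⟩
        · rw [hVdef, Finset.mem_filter]
          refine ⟨hs, fun h => h1 (by rw [hLdef, Finset.mem_filter]; exact ⟨hs, h⟩),
            (hmono q1).trans_lt hx.2, hx.1.trans (hmono q2)⟩
        · rw [hVdef, Finset.mem_filter]
          refine ⟨ht, fun h => h2 (by rw [hLdef, Finset.mem_filter]; exact ⟨ht, h⟩),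
            (hmono q3).trans_lt hx.2, hx.1.trans (hmono q4)⟩
    have c1 := Finset.card_le_card hsub
    have c2 := Finset.card_union_le (X ∪ X.image Prod.swap)
      ((V ×ˢ V).filter (fun p => p.1 ≠ p.2 ∧ Mt l r a b I p.1 p.2))
    have c3 := Finset.card_union_le X (X.image Prod.swap)
    have c4 : (X.image Prod.swap).card ≤ X.card := Finset.card_image_le
    have c5 := Finset.card_le_card hLW
    have c6 : 2 * k * (k * (L.card + W.card)) ≤ 4 * k ^ 2 * W.card := by
      calc 2 * k * (k * (L.card + W.card)) ≤ 2 * k * (k * (W.card + W.card)) := by gcongr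
        _ = _ := by ring
    have c7 : 8 * k ^ 2 * W.card = 2 * (4 * k ^ 2 * W.card) := by ring
    omega
  induction d with
  | zero =>
    intro i W hW
    refine (key 0 i W hW).trans ?_
    have : W.filter (fun s => ¬ (idx (l s) ≤ i ∧ i + 2 ^ 0 ≤ idx (r s) + 1) ∧
          idx (l s) < i + 2 ^ 0 ∧ i ≤ idx (r s)) = ∅ := by
      rw [Finset.filter_eq_empty_iff]
      intro s _ h
      apply h.1
      have := h.2
      simp only [pow_zero] at this ⊢
      omega
    rw [this]
    simp
  | succ d ih =>
    intro i W hW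
    refine (key (d + 1) i W hW).trans ?_
    set V := W.filter (fun s => ¬ (idx (l s) ≤ i ∧ i + 2 ^ (d + 1) ≤ idx (r s) + 1) ∧
          idx (l s) < i + 2 ^ (d + 1) ∧ i ≤ idx (r s)) with hVdef
    have hVW : V ⊆ W := Finset.filter_subset _ _
    have h1 := ih i V (hVW.trans hW)
    have h2 := ih (i + 2 ^ d) V (hVW.trans hW)
    have hpow : 2 ^ (d + 1) = 2 ^ d + 2 ^ d := by ring
    -- splitting of pairs
    have hs := Finset.card_le_card (show
        (V ×ˢ V).filter (fun p => p.1 ≠ p.2 ∧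
          Mt l r a b {x | i ≤ idx x ∧ idx x < i + 2 ^ (d + 1)} p.1 p.2) ⊆
        ((V ×ˢ V).filter (fun p => p.1 ≠ p.2 ∧
          Mt l r a b {x | i ≤ idx x ∧ idx x < i + 2 ^ d} p.1 p.2)) ∪
        ((V ×ˢ V).filter (fun p => p.1 ≠ p.2 ∧
          Mt l r a b {x | i + 2 ^ d ≤ idx x ∧ idx x < i + 2 ^ d + 2 ^ d} p.1 p.2)) by
      intro p hp
      simp only [Finset.mem_union, Finset.mem_filter] at hp ⊢
      obtain ⟨hp1, hne, x, hx, hM⟩ := hp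
      rw [Set.mem_setOf_eq, hpow] at hx
      rcases lt_or_ge (idx x) (i + 2 ^ d) with h | h
      · left; exact ⟨hp1, hne, x, ⟨hx.1, h⟩, hM⟩
      · right; exact ⟨hp1, hne, x, ⟨h, by omega⟩, hM⟩)
    have hs2 := hs.trans (Finset.card_union_le _ _)
    -- endpoints
    have hend : ∀ f : ι → ℝ,
        (V.filter (fun s => i ≤ idx (f s) ∧ idx (f s) < i + 2 ^ d)).card +
        (V.filter (fun s => i + 2 ^ d ≤ idx (f s) ∧ idx (f s) < i + 2 ^ d + 2 ^ d)).card ≤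
        (W.filter (fun s => i ≤ idx (f s) ∧ idx (f s) < i + 2 ^ (d + 1))).card := by
      intro f
      rw [← Finset.card_union_of_disjoint]
      · apply Finset.card_le_card
        intro s hs
        simp only [Finset.mem_union, Finset.mem_filter] at hs ⊢
        rcases hs with h | h
        · exact ⟨hVW h.1, by omega⟩
        · exact ⟨hVW h.1, by omega⟩
      · rw [Finset.disjoint_filter]
        intro s _ h1 h2
        omega
    have hl' := hend l
    have hr' := hend r
    have hV : V.card ≤
        (W.filter (fun s => i ≤ idx (l s) ∧ idx (l s) < i + 2 ^ (d + 1))).card +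
         (W.filter (fun s => i ≤ idx (r s) ∧ idx (r s) < i + 2 ^ (d + 1))).card := by
      refine le_trans (Finset.card_le_card ?_) (Finset.card_union_le _ _)
      intro s hs
      rw [hVdef, Finset.mem_filter] at hs
      simp only [Finset.mem_union, Finset.mem_filter]
      obtain ⟨hsW, h1, h2, h3⟩ := hs
      by_cases h : idx (l s) ≤ i
      · right; refine ⟨hsW, h3, ?_⟩
        by_contra hc
        exact h1 ⟨h, by omega⟩
      · left; exact ⟨hsW, by omega, h2⟩
    generalize (W.filter (fun s => i ≤ idx (l s) ∧ idx (l s) < i + 2 ^ (d + 1))).card = el at *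
    generalize (W.filter (fun s => i ≤ idx (r s) ∧ idx (r s) < i + 2 ^ (d + 1))).card = er at *
    generalize (V.filter (fun s => i ≤ idx (l s) ∧ idx (l s) < i + 2 ^ d)).card = e1 at *
    generalize (V.filter (fun s => i ≤ idx (r s) ∧ idx (r s) < i + 2 ^ d)).card = e2 at *
    generalize (V.filter (fun s => i + 2 ^ d ≤ idx (l s) ∧
      idx (l s) < i + 2 ^ d + 2 ^ d)).card = e3 at *
    generalize (V.filter (fun s => i + 2 ^ d ≤ idx (r s) ∧
      idx (r s) < i + 2 ^ d + 2 ^ d)).card = e4 at *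
    generalize 8 * k ^ 2 = K at *
    have hfin : K * V.card + 2 * K * d * (e1 + e2) + (K * V.card + 2 * K * d * (e3 + e4)) ≤
        2 * K * (d + 1) * (el + er) := by
      calc _ = 2 * K * V.card + 2 * K * d * ((e1 + e3) + (e2 + e4)) := by ring
        _ ≤ 2 * K * (el + er) + 2 * K * d * (el + er) := by gcongr
        _ = _ := by ring
    omega

open Classical in
lemma abstract_count {ι : Type*} (l r a b : ι → ℝ) (k : ℕ) (S : Finset ι)
    (hS : KFree l r a b k S) :
    ((S ×ˢ S).filter (fun p => p.1 ≠ p.2 ∧ Mt l r a b Set.univ p.1 p.2)).card ≤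
      8 * k ^ 2 * S.card + 2 * (8 * k ^ 2) * (Nat.log 2 (4 * S.card) + 1) *
        (S.card + S.card) := by
  set X := S.image l ∪ S.image r with hX
  set d := Nat.log 2 (4 * S.card) + 1 with hd
  let idx : ℝ → ℕ := fun x => (X.filter (fun y => y < x)).card + (X.filter (fun y => y ≤ x)).card
  have hXc : X.card ≤ S.card + S.card := (Finset.card_union_le _ _).trans
    (add_le_add Finset.card_image_le Finset.card_image_le)
  have hlt : ∀ x y, x < y → (x ∈ X ∨ y ∈ X) → idx x < idx y := by
    intro x y hxy hor
    have s1 : X.filter (fun z => z < x) ⊆ X.filter (fun z => z < y) := by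
      intro z hz; simp only [Finset.mem_filter] at hz ⊢; exact ⟨hz.1, hz.2.trans hxy⟩
    have s2 : X.filter (fun z => z ≤ x) ⊆ X.filter (fun z => z ≤ y) := by
      intro z hz; simp only [Finset.mem_filter] at hz ⊢; exact ⟨hz.1, hz.2.trans hxy.le⟩
    rcases hor with h | h
    · refine add_lt_add_of_lt_of_le (Finset.card_lt_card ?_) (Finset.card_le_card s2)
      exact (Finset.ssubset_iff_of_subset s1).2 ⟨x, by simp [h, hxy], by simp⟩
    · refine add_lt_add_of_le_of_lt (Finset.card_le_card s1) (Finset.card_lt_card ?_)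
      exact (Finset.ssubset_iff_of_subset s2).2 ⟨y, by simp [h], by simp [hxy]⟩
  have hmono : Monotone idx := by
    intro x y hxy
    refine add_le_add (Finset.card_le_card ?_) (Finset.card_le_card ?_)
    · intro z hz; simp only [Finset.mem_filter] at hz ⊢; exact ⟨hz.1, hz.2.trans_le hxy⟩
    · intro z hz; simp only [Finset.mem_filter] at hz ⊢; exact ⟨hz.1, hz.2.trans hxy⟩
  have hb : ∀ x, idx x < 2 ^ d := by
    intro x
    have h1 : (X.filter (fun y => y < x)).card ≤ X.card := Finset.card_filter_le _ _
    have h2 : (X.filter (fun y => y ≤ x)).card ≤ X.card := Finset.card_filter_le _ _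
    have h3 : 4 * S.card < 2 ^ d := Nat.lt_pow_succ_log_self (by norm_num) _
    have : idx x = (X.filter (fun y => y < x)).card + (X.filter (fun y => y ≤ x)).card := rfl
    omega
  have hlX : ∀ s ∈ S, l s ∈ X := fun s hs =>
    Finset.mem_union_left _ (Finset.mem_image_of_mem _ hs)
  have hrX : ∀ s ∈ S, r s ∈ X := fun s hs =>
    Finset.mem_union_right _ (Finset.mem_image_of_mem _ hs)
  have main := dyadic l r a b k S hS idx hmono
    (by
      intro s hs x h
      by_contra hc
      push Not at hc
      have := hlt x (l s) hc (Or.inr (hlX s hs))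
      omega)
    (by
      intro s hs x h
      by_contra hc
      push Not at hc
      have := hlt (r s) x hc (Or.inl (hrX s hs))
      omega) d 0 S subset_rfl
  have hu : {x : ℝ | 0 ≤ idx x ∧ idx x < 0 + 2 ^ d} = Set.univ := by
    ext x; simp [hb x]
  rw [hu] at main
  refine main.trans ?_
  gcongr
  · exact Finset.filter_subset _ _
  · exact Finset.filter_subset _ _

lemma seg_param_aux (ε : ℝ) (p q : ℝ × ℝ) (h : p.1 + ε * p.2 < q.1 + ε * q.2) :
    ∃ l r a b : ℝ, ∀ z : ℝ × ℝ, z ∈ segment ℝ p q ↔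
      l ≤ z.1 + ε * z.2 ∧ z.1 + ε * z.2 ≤ r ∧ a * (z.1 + ε * z.2) + b = z.2 := by
  obtain ⟨p1, p2⟩ := p
  obtain ⟨q1, q2⟩ := q
  simp only at h
  set P := p1 + ε * p2 with hP
  set Q := q1 + ε * q2 with hQ
  have hD : 0 < Q - P := sub_pos.2 h
  refine ⟨P, Q, (q2 - p2) / (Q - P), p2 - (q2 - p2) / (Q - P) * P, ?_⟩
  rintro ⟨z1, z2⟩
  simp only
  constructor
  · rw [segment_eq_image]
    rintro ⟨t, ⟨ht0, ht1⟩, hz⟩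
    simp only [Prod.smul_mk, Prod.mk_add_mk, smul_eq_mul, Prod.mk.injEq] at hz
    obtain ⟨e1, e2⟩ := hz
    have hf : z1 + ε * z2 = P + t * (Q - P) := by rw [← e1, ← e2, hP, hQ]; ring
    rw [hf]
    refine ⟨by nlinarith, by nlinarith, ?_⟩
    field_simp
    rw [← e2]; ring
  · rintro ⟨h1, h2, h3⟩
    rw [segment_eq_image]
    set Z := z1 + ε * z2 with hZ
    have hz2 : z2 = p2 + (Z - P) / (Q - P) * (q2 - p2) := by
      rw [← h3]; field_simp; ring
    refine ⟨(Z - P) / (Q - P), ⟨div_nonneg (by linarith) hD.le, ?_⟩, ?_⟩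
    · rw [div_le_one hD]; linarith
    · simp only [Prod.smul_mk, Prod.mk_add_mk, smul_eq_mul, Prod.mk.injEq]
      have hz2' : (1 - (Z - P) / (Q - P)) * p2 + (Z - P) / (Q - P) * q2 = z2 := by
        rw [hz2]; ring
      refine ⟨?_, hz2'⟩
      have e1 : (1 - (Z - P) / (Q - P)) * P + (Z - P) / (Q - P) * Q = Z := by
        field_simp; ring
      have e2 : z1 = Z - ε * z2 := by rw [hZ]; ring
      rw [e2, ← hz2']
      nth_rewrite 3 [← e1]
      rw [hP, hQ]
      ring

lemma seg_param (ε : ℝ) (p q : ℝ × ℝ) (h : p.1 + ε * p.2 ≠ q.1 + ε * q.2) :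
    ∃ l r a b : ℝ, ∀ z : ℝ × ℝ, z ∈ segment ℝ p q ↔
      l ≤ z.1 + ε * z.2 ∧ z.1 + ε * z.2 ≤ r ∧ a * (z.1 + ε * z.2) + b = z.2 := by
  rcases lt_or_gt_of_ne h with h | h
  · exact seg_param_aux ε p q h
  · rw [segment_symm]; exact seg_param_aux ε q p h

lemma exists_shear (S : Finset (Set (ℝ × ℝ)))
    (hS : ∀ s ∈ S, ∃ a b : ℝ × ℝ, a ≠ b ∧ s = segment ℝ a b) :
    ∃ ε : ℝ, ∃ l r a b : Set (ℝ × ℝ) → ℝ, ∀ s ∈ S, ∀ z : ℝ × ℝ, z ∈ s ↔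
      l s ≤ z.1 + ε * z.2 ∧ z.1 + ε * z.2 ≤ r s ∧ a s * (z.1 + ε * z.2) + b s = z.2 := by
  classical
  have hS' : ∀ s : Set (ℝ × ℝ), ∃ p q : ℝ × ℝ, s ∈ S → p ≠ q ∧ s = segment ℝ p q := by
    intro s
    by_cases h : s ∈ S
    · obtain ⟨p, q, h'⟩ := hS s h; exact ⟨p, q, fun _ => h'⟩
    · exact ⟨0, 0, fun h' => absurd h' h⟩
  choose p q hpq using hS'
  obtain ⟨ε, hε⟩ := Infinite.exists_notMem_finset
    (S.image (fun s => -((p s).1 - (q s).1) / ((p s).2 - (q s).2)))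
  refine ⟨ε, ?_⟩
  have : ∀ s : Set (ℝ × ℝ), ∃ l r a b : ℝ, s ∈ S → ∀ z : ℝ × ℝ, z ∈ s ↔
      l ≤ z.1 + ε * z.2 ∧ z.1 + ε * z.2 ≤ r ∧ a * (z.1 + ε * z.2) + b = z.2 := by
    intro s
    by_cases h : s ∈ S
    · obtain ⟨hne, hs⟩ := hpq s h
      obtain ⟨l, r, a, b, H⟩ := seg_param ε (p s) (q s) (by
        intro heq
        by_cases h2 : (p s).2 = (q s).2
        · apply hne
          rw [h2] at heq
          exact Prod.ext (by linarith) h2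
        · apply hε
          rw [Finset.mem_image]
          refine ⟨s, h, ?_⟩
          have : (p s).2 - (q s).2 ≠ 0 := sub_ne_zero.2 h2
          rw [div_eq_iff this]
          linarith)
      refine ⟨l, r, a, b, fun _ z => ?_⟩
      rw [← H z, ← hs]
    · exact ⟨0, 0, 0, 0, fun h' => absurd h' h⟩
  choose l r a b H using this
  exact ⟨l, r, a, b, fun s hs => H s hs⟩

theorem stmt5 (k : ℕ) (hk : 1 ≤ k) :
    ∃ C c : ℝ, 0 < C ∧ 0 < c ∧
      ∀ S : Finset (Set (ℝ × ℝ)), 2 ≤ S.card →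
        (∀ s ∈ S, ∃ a b : ℝ × ℝ, a ≠ b ∧ s = segment ℝ a b) →
        (¬ ∃ A B : Finset (Set (ℝ × ℝ)), A ⊆ S ∧ B ⊆ S ∧ Disjoint A B ∧
            A.card = k ∧ B.card = k ∧ ∀ a ∈ A, ∀ b ∈ B, (a ∩ b).Nonempty) →
        ({P : Finset (Set (ℝ × ℝ)) | P ⊆ S ∧ P.card = 2 ∧
            ∃ s ∈ P, ∃ t ∈ P, s ≠ t ∧ (s ∩ t).Nonempty}.ncard : ℝ) ≤
          C * (S.card : ℝ) * Real.log (S.card : ℝ) ^ c := by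
  classical
  have hlog2 : 0 < Real.log 2 := Real.log_pos (by norm_num)
  have hkR : (0 : ℝ) < k := by exact_mod_cast hk
  refine ⟨17 * (8 * (k : ℝ) ^ 2) / Real.log 2, 1, by positivity, one_pos, ?_⟩
  intro S hn hseg hfree
  obtain ⟨ε, l, r, a, b, H⟩ := exists_shear S hseg
  have hmeet : ∀ s ∈ S, ∀ t ∈ S, (s ∩ t).Nonempty ↔ Mt l r a b Set.univ s t := by
    intro s hs t ht
    constructor
    · rintro ⟨z, hz1, hz2⟩
      obtain ⟨h1, h2, h3⟩ := (H s hs z).1 hz1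
      obtain ⟨h4, h5, h6⟩ := (H t ht z).1 hz2
      exact ⟨z.1 + ε * z.2, trivial, h1, h2, h4, h5, h3.trans h6.symm⟩
    · rintro ⟨x, -, h1, h2, h3, h4, h5⟩
      have hx : (x - ε * (a s * x + b s)) + ε * (a s * x + b s) = x := by ring
      refine ⟨(x - ε * (a s * x + b s), a s * x + b s), (H s hs _).2 ?_, (H t ht _).2 ?_⟩
      · simp only [hx]; exact ⟨h1, h2, trivial⟩
      · simp only [hx]; exact ⟨h3, h4, h5.symm⟩
  have hK : KFree l r a b k S := by
    intro A hA B hB hd hAk hBk hAB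
    exact hfree ⟨A, B, hA, hB, hd, hAk, hBk, fun s hs t ht =>
      (hmeet s (hA hs) t (hB ht)).2 (hAB s hs t ht)⟩
  have hcount := abstract_count l r a b k S hK
  set E := (S ×ˢ S).filter (fun p => p.1 ≠ p.2 ∧ Mt l r a b Set.univ p.1 p.2) with hE
  have hsub : {P : Finset (Set (ℝ × ℝ)) | P ⊆ S ∧ P.card = 2 ∧
            ∃ s ∈ P, ∃ t ∈ P, s ≠ t ∧ (s ∩ t).Nonempty} ⊆
      ((E.image (fun p => ({p.1, p.2} : Finset (Set (ℝ × ℝ)))) : Finset _) :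
        Set (Finset (Set (ℝ × ℝ)))) := by
    rintro P ⟨hP, hP2, s, hs, t, ht, hst, hne⟩
    rw [Finset.mem_coe, Finset.mem_image]
    refine ⟨(s, t), ?_, ?_⟩
    · rw [hE, Finset.mem_filter, Finset.mem_product]
      exact ⟨⟨hP hs, hP ht⟩, hst, (hmeet s (hP hs) t (hP ht)).1 hne⟩
    · apply Finset.eq_of_subset_of_card_le
      · intro x hx
        simp only [Finset.mem_insert, Finset.mem_singleton] at hx
        rcases hx with rfl | rfl
        · exact hs
        · exact ht
      · rw [hP2, Finset.card_pair hst]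
  have hle := Set.ncard_le_ncard hsub (Finset.finite_toSet _)
  rw [Set.ncard_coe_finset] at hle
  have hle2 := (hle.trans Finset.card_image_le).trans hcount
  generalize {P : Finset (Set (ℝ × ℝ)) | P ⊆ S ∧ P.card = 2 ∧
            ∃ s ∈ P, ∃ t ∈ P, s ≠ t ∧ (s ∩ t).Nonempty}.ncard = M at *
  set n := S.card with hndef
  have hle3 : (M : ℝ) ≤ 8 * (k : ℝ) ^ 2 * n +
      2 * (8 * (k : ℝ) ^ 2) * ((Nat.log 2 (4 * n) : ℝ) + 1) * (n + n) := by
    exact_mod_cast hle2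
  have hnR : (2 : ℝ) ≤ n := by exact_mod_cast hn
  have hn0 : (0 : ℝ) < n := by linarith
  have hlogn : Real.log 2 ≤ Real.log n := Real.log_le_log (by norm_num) hnR
  set u := Real.log n / Real.log 2 with hu
  have hu1 : 1 ≤ u := by rw [hu, le_div_iff₀ hlog2]; linarith
  have hNL : (Nat.log 2 (4 * n) : ℝ) ≤ 2 + u := by
    have h1 : 2 ^ Nat.log 2 (4 * n) ≤ 4 * n := Nat.pow_log_le_self 2 (by omega)
    have h2 : (2 : ℝ) ^ Nat.log 2 (4 * n) ≤ 4 * n := by exact_mod_cast h1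
    have h3 := Real.log_le_log (by positivity) h2
    rw [Real.log_pow, Real.log_mul (by norm_num) hn0.ne',
      show (4 : ℝ) = 2 ^ 2 by norm_num, Real.log_pow] at h3
    have h4 : Real.log n = u * Real.log 2 := by rw [hu]; field_simp
    rw [h4] at h3
    push_cast at h3
    have h5 : (Nat.log 2 (4 * n) : ℝ) * Real.log 2 ≤ (2 + u) * Real.log 2 := by
      norm_num at h3 ⊢
      linarith
    exact le_of_mul_le_mul_right h5 hlog2
  rw [Real.rpow_one]
  have hgoal : 17 * (8 * (k : ℝ) ^ 2) / Real.log 2 * n * Real.log n =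
      (8 * (k : ℝ) ^ 2 * n) * (17 * u) := by rw [hu]; field_simp
  rw [hgoal]
  calc (M : ℝ) ≤ _ := hle3
    _ = (8 * (k : ℝ) ^ 2 * n) * (1 + 4 * (Nat.log 2 (4 * n) + 1)) := by ring
    _ ≤ (8 * (k : ℝ) ^ 2 * n) * (17 * u) := by
      gcongr
      linarith
end
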